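/- arXiv:1905.01970 — 8 statements merged into one kernel-verified Lean document; each statement's English description precedes it below -/
import Mathlib

section
/- Fix ρ₀ > 0 and c > 0. Let (γₙ) be a sequence in (1,2) with γₙ → 1, and let (ρₙ) be a sequence of positive reals with ρₙ ≠ ρ₀ for all n and ρₙ → c. Then √( ((γₙ−1)/2)·(ρₙ^{γₙ−1} − ρ₀^{γₙ−1}) / (ρₙ² − ρ₀²) ) · |ρₙ − ρ₀| → 0 as n → ∞. -/
open Real Filter Topology

/-- Limit (4.10): along any sequence γₙ → 1 in (1,2) with densities ρₙ → c ∈ (0,∞),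
the shock-curve increments vanish. -/
theorem limit_eq410 (ρ₀ c : ℝ) (hρ₀ : 0 < ρ₀) (hc : 0 < c)
    (γ : ℕ → ℝ) (hγ : ∀ n, γ n ∈ Set.Ioo (1 : ℝ) 2)
    (hγlim : Tendsto γ atTop (𝓝 1))
    (ρ : ℕ → ℝ) (hρpos : ∀ n, 0 < ρ n) (hρne : ∀ n, ρ n ≠ ρ₀)
    (hρlim : Tendsto ρ atTop (𝓝 c)) :
    Tendsto
      (fun n =>
        Real.sqrt (((γ n - 1) / 2) * ((ρ n) ^ (γ n - 1) - ρ₀ ^ (γ n - 1)) /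
          ((ρ n) ^ 2 - ρ₀ ^ 2)) * |ρ n - ρ₀|)
      atTop (𝓝 0) := by
  have hγ0 : Tendsto (fun n => γ n - 1) atTop (𝓝 0) := by
    simpa using hγlim.sub_const 1
  have hpow : Tendsto (fun n => ρ n ^ (γ n - 1)) atTop (𝓝 (c ^ (0 : ℝ))) :=
    hρlim.rpow hγ0 (Or.inl hc.ne')
  have hpow₀ : Tendsto (fun n => ρ₀ ^ (γ n - 1)) atTop (𝓝 (ρ₀ ^ (0 : ℝ))) :=
    tendsto_const_nhds.rpow hγ0 (Or.inl hρ₀.ne')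
  have hlim := ((((hγ0.div_const 2).mul (hpow.sub hpow₀)).mul (hρlim.sub_const ρ₀)).div
    (hρlim.add_const ρ₀) (add_pos hc hρ₀).ne').sqrt
  simp only [Pi.div_apply, zero_div, zero_mul, Real.sqrt_zero] at hlim
  refine hlim.congr fun n => ?_
  have hsub : ρ n - ρ₀ ≠ 0 := sub_ne_zero.mpr (hρne n)
  have hadd : ρ n + ρ₀ ≠ 0 := (add_pos (hρpos n) hρ₀).ne'
  rw [← Real.sqrt_sq_eq_abs, ← Real.sqrt_mul' _ (sq_nonneg _), sq_sub_sq]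
  congr 1
  field_simp
end

section
/- Let ρ₋, ρ₊ > 0 and u₋ > u₊. Suppose ρ* : (1,2) → ℝ is a continuous function such that for every γ ∈ (1,2), ρ*(γ) > max(ρ₋,ρ₊) and u₋ − u₊ = Θ_γ(ρ*(γ),ρ₋)·(ρ*(γ) − ρ₋) + Θ_γ(ρ*(γ),ρ₊)·(ρ*(γ) − ρ₊). Then ρ*(γ) → +∞ as γ → 1⁺. -/
open Real Filter Topology

/-- The shock-curve slope coefficient Θ_γ(a,b) from equation (4.9). -/
noncomputable def Theta (γ a b : ℝ) : ℝ :=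
  Real.sqrt (((γ - 1) / 2) * (a ^ (γ - 1) - b ^ (γ - 1)) / ((a + b) * (a - b)))

lemma Theta_mul_sub_le {γ a b M : ℝ} (hγ : γ ∈ Set.Ioo (1 : ℝ) 2) (hb : 0 < b) (hab : b < a)
    (haM : a ≤ M) : Theta γ a b * (a - b) ≤ √((γ - 1) * (1 + M)) := by
  obtain ⟨h1, h2⟩ := hγ
  have hd : 0 < a - b := sub_pos.2 hab
  have hs : 0 < a + b := by linarith
  have hpow : a ^ (γ - 1) - b ^ (γ - 1) ≤ 1 + M := by
    have hb' : 0 < b ^ (γ - 1) := rpow_pos_of_pos hb _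
    have h3 : a ^ (γ - 1) ≤ (1 + M) ^ (γ - 1) :=
      rpow_le_rpow (by linarith) (by linarith) (by linarith)
    have h4 : (1 + M) ^ (γ - 1) ≤ (1 + M) ^ (1 : ℝ) :=
      rpow_le_rpow_of_exponent_le (by linarith) (by linarith)
    rw [rpow_one] at h4
    linarith
  have hpow0 : 0 ≤ a ^ (γ - 1) - b ^ (γ - 1) :=
    sub_nonneg.2 (rpow_le_rpow hb.le hab.le (by linarith))
  rw [Theta, ← sqrt_sq hd.le, ← sqrt_mul' _ (sq_nonneg _), sqrt_sq hd.le]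
  apply sqrt_le_sqrt
  calc (γ - 1) / 2 * (a ^ (γ - 1) - b ^ (γ - 1)) / ((a + b) * (a - b)) * (a - b) ^ 2
      = (γ - 1) / 2 * (a ^ (γ - 1) - b ^ (γ - 1)) * ((a - b) / (a + b)) := by
        field_simp
    _ ≤ (γ - 1) / 2 * (a ^ (γ - 1) - b ^ (γ - 1)) * 1 := by
        have hq : (a - b) / (a + b) ≤ 1 := (div_le_one hs).2 (by linarith)
        exact mul_le_mul_of_nonneg_left hq (mul_nonneg (by linarith) hpow0)
    _ ≤ (γ - 1) * (1 + M) := by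
        rw [mul_one]
        exact mul_le_mul (by linarith) hpow hpow0 (by linarith)

/-- Lemma 4.2, first assertion: the intermediate density of the two-shock Riemann
solution blows up as γ → 1⁺. -/
theorem lemma42_blowup (ρm ρp um up : ℝ) (hρm : 0 < ρm) (hρp : 0 < ρp)
    (hu : up < um) (ρs : ℝ → ℝ) (hcont : ContinuousOn ρs (Set.Ioo (1 : ℝ) 2))
    (hgt : ∀ γ ∈ Set.Ioo (1 : ℝ) 2, ρs γ > max ρm ρp)
    (heq : ∀ γ ∈ Set.Ioo (1 : ℝ) 2,
      um - up = Theta γ (ρs γ) ρm * (ρs γ - ρm) + Theta γ (ρs γ) ρp * (ρs γ - ρp)) :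
    Tendsto ρs (𝓝[>] (1 : ℝ)) atTop := by
  refine tendsto_atTop.2 fun M => ?_
  have hlim : Tendsto (fun γ : ℝ => 2 * √((γ - 1) * (1 + M))) (𝓝[>] 1) (𝓝 0) := by
    have hc : Continuous fun γ : ℝ => 2 * √((γ - 1) * (1 + M)) := by fun_prop
    have := hc.tendsto 1
    simp only [sub_self, zero_mul, sqrt_zero, mul_zero] at this
    exact this.mono_left nhdsWithin_le_nhds
  filter_upwards [hlim.eventually_lt_const (sub_pos.2 hu),
    Ioo_mem_nhdsGT (one_lt_two : (1 : ℝ) < 2)] with γ hsmall hγ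
  by_contra! hM
  have hmax := max_lt_iff.1 (hgt γ hγ)
  have hm := Theta_mul_sub_le hγ hρm hmax.1 hM.le
  have hp := Theta_mul_sub_le hγ hρp hmax.2 hM.le
  linarith [heq γ hγ]
end

section
/- Let ρ₋, ρ₊ > 0, u₋ > u₊, β ∈ ℝ and t ≥ 0. Suppose ρ* : (1,2) → ℝ is a continuous function such that for every γ ∈ (1,2), ρ*(γ) > max(ρ₋,ρ₊) and u₋ − u₊ = Θ_γ(ρ*(γ),ρ₋)·(ρ*(γ) − ρ₋) + Θ_γ(ρ*(γ),ρ₊)·(ρ*(γ) − ρ₊). Define v*(γ) = u₋ − Θ_γ(ρ*(γ),ρ₋)·(ρ*(γ) − ρ₋). Then v*(γ) + βt → (u₋ + u₊)/2 + βt as γ → 1⁺. -/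
open Real Filter Topology

/-- The square of the velocity jump `Θ_γ(a,b)(a - b)` across a shock. -/
lemma Theta_mul_sub_sq {γ a b : ℝ} (hγ : 1 ≤ γ) (hb : 0 < b) (hab : b < a) :
    (Theta γ a b * (a - b)) ^ 2 =
      (γ - 1) / 2 * ((a ^ (γ - 1) - b ^ (γ - 1)) * ((a - b) / (a + b))) := by
  have h1 : b ^ (γ - 1) ≤ a ^ (γ - 1) := Real.rpow_le_rpow hb.le hab.le (by linarith)
  have h2 : 0 < a - b := sub_pos.2 hab
  have h3 : 0 < a + b := by linarith
  have h4 : 0 ≤ (γ - 1) / 2 * (a ^ (γ - 1) - b ^ (γ - 1)) / ((a + b) * (a - b)) :=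
    div_nonneg (mul_nonneg (by linarith) (by linarith)) (mul_pos h3 h2).le
  rw [Theta, mul_pow, Real.sq_sqrt h4]
  field_simp

/-- The squared velocity jumps from `a` to two smaller densities differ by a bound that
depends only on a lower bound `M` for `a`. -/
lemma abs_Theta_mul_sub_sq_sub_le {γ a b c M : ℝ} (hγ : γ ∈ Set.Ioo (1 : ℝ) 2) (hb : 0 < b)
    (hc : 0 < c) (hM : 0 < M) (hMa : M ≤ a) (hab : b < a) (hac : c < a) :
    |(Theta γ a b * (a - b)) ^ 2 - (Theta γ a c * (a - c)) ^ 2| ≤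
      (γ - 1) / 2 * (2 * |c - b| * M ^ (γ - 1 - 1) + (b ^ (γ - 1) + c ^ (γ - 1))) := by
  obtain ⟨hγ1, hγ2⟩ := hγ
  have ha : 0 < a := hb.trans hab
  have ratio_abs_le : ∀ {x : ℝ}, 0 < x → x < a → |(a - x) / (a + x)| ≤ 1 := by
    intro x hx hxa
    rw [abs_of_nonneg (div_nonneg (by linarith) (by linarith)), div_le_one (by linarith)]
    linarith
  have hterm : ∀ {x : ℝ}, 0 < x → x < a →
      |x ^ (γ - 1) * ((a - x) / (a + x))| ≤ x ^ (γ - 1) := by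
    intro x hx hxa
    rw [abs_mul, abs_of_pos (Real.rpow_pos_of_pos hx _)]
    exact mul_le_of_le_one_right (Real.rpow_pos_of_pos hx _).le (ratio_abs_le hx hxa)
  have hdiff : (a - b) / (a + b) - (a - c) / (a + c) =
      2 * a * (c - b) / ((a + b) * (a + c)) := by
    field_simp
    ring
  have hdiff_le : |(a - b) / (a + b) - (a - c) / (a + c)| ≤ 2 * |c - b| / a := by
    rw [hdiff, abs_div, abs_mul, abs_of_pos (by positivity : 0 < 2 * a),
      abs_of_pos (by positivity : 0 < (a + b) * (a + c)),
      div_le_div_iff₀ (by positivity) ha]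
    have : a * a ≤ (a + b) * (a + c) := by nlinarith [mul_pos ha hb, mul_pos ha hc, mul_pos hb hc]
    nlinarith [mul_le_mul_of_nonneg_left this (abs_nonneg (c - b))]
  have hmain : |a ^ (γ - 1) * ((a - b) / (a + b) - (a - c) / (a + c))| ≤
      2 * |c - b| * M ^ (γ - 1 - 1) := by
    rw [abs_mul, abs_of_pos (Real.rpow_pos_of_pos ha _)]
    calc a ^ (γ - 1) * |(a - b) / (a + b) - (a - c) / (a + c)|
        ≤ a ^ (γ - 1) * (2 * |c - b| / a) :=
          mul_le_mul_of_nonneg_left hdiff_le (Real.rpow_pos_of_pos ha _).le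
      _ = 2 * |c - b| * a ^ (γ - 1 - 1) := by
          rw [Real.rpow_sub_one ha.ne' (γ - 1)]
          ring
      _ ≤ 2 * |c - b| * M ^ (γ - 1 - 1) :=
          mul_le_mul_of_nonneg_left
            (Real.rpow_le_rpow_of_nonpos hM hMa (by linarith)) (by positivity)
  rw [Theta_mul_sub_sq hγ1.le hb hab, Theta_mul_sub_sq hγ1.le hc hac, ← mul_sub, abs_mul,
    abs_of_pos (by linarith : 0 < (γ - 1) / 2)]
  refine mul_le_mul_of_nonneg_left ?_ (by linarith)
  have hB := abs_le.1 (hterm hb hab)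
  have hC := abs_le.1 (hterm hc hac)
  have hD := abs_le.1 hmain
  rw [abs_le]
  constructor <;> linarith [hB.1, hB.2, hC.1, hC.2, hD.1, hD.2]

/-- Lemma 4.3: the intermediate velocity v*(γ) + βt tends to the delta-shock speed
u_δ(t) = (u₋+u₊)/2 + βt as γ → 1⁺. -/
theorem lemma43_velocity (ρm ρp um up β t : ℝ) (hρm : 0 < ρm) (hρp : 0 < ρp)
    (hu : up < um) (ht : 0 ≤ t)
    (ρs : ℝ → ℝ) (hcont : ContinuousOn ρs (Set.Ioo (1 : ℝ) 2))
    (hgt : ∀ γ ∈ Set.Ioo (1 : ℝ) 2, ρs γ > max ρm ρp)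
    (heq : ∀ γ ∈ Set.Ioo (1 : ℝ) 2,
      um - up = Theta γ (ρs γ) ρm * (ρs γ - ρm) + Theta γ (ρs γ) ρp * (ρs γ - ρp)) :
    Tendsto (fun γ : ℝ => (um - Theta γ (ρs γ) ρm * (ρs γ - ρm)) + β * t)
      (𝓝[>] (1 : ℝ)) (𝓝 ((um + up) / 2 + β * t)) := by
  have hM : 0 < max ρm ρp := lt_max_of_lt_left hρm
  have hD : 0 < um - up := sub_pos.2 hu
  refine Tendsto.add_const _ (tendsto_iff_dist_tendsto_zero.2 ?_)
  have hpow : ∀ {x : ℝ} (s : ℝ), 0 < x → ContinuousAt (fun γ : ℝ => x ^ (γ - s)) 1 :=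
    fun s hx => ContinuousAt.rpow continuousAt_const (by fun_prop) (Or.inl hx.ne')
  have hbound : Tendsto (fun γ : ℝ => (γ - 1) / 2 * (2 * |ρp - ρm| * max ρm ρp ^ (γ - 1 - 1) +
      (ρm ^ (γ - 1) + ρp ^ (γ - 1))) / (2 * (um - up))) (𝓝[>] (1 : ℝ)) (𝓝 0) := by
    have hcts : ContinuousAt (fun γ : ℝ => (γ - 1) / 2 *
        (2 * |ρp - ρm| * max ρm ρp ^ (γ - 1 - 1) +
          (ρm ^ (γ - 1) + ρp ^ (γ - 1))) / (2 * (um - up))) 1 := by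
      have h1 := hpow 1 hρm
      have h2 := hpow 1 hρp
      have h3 : ContinuousAt (fun γ : ℝ => max ρm ρp ^ (γ - 1 - 1)) 1 := by
        simpa only [sub_sub] using hpow (1 + 1) hM
      fun_prop
    simpa using hcts.tendsto.mono_left nhdsWithin_le_nhds
  refine squeeze_zero' (Eventually.of_forall fun _ => dist_nonneg) ?_ hbound
  filter_upwards [Ioo_mem_nhdsGT (by norm_num : (1 : ℝ) < 2)] with γ hγ
  have hgtγ := hgt γ hγ
  have hle := abs_Theta_mul_sub_sq_sub_le hγ hρm hρp hM hgtγ.le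
    ((le_max_left _ _).trans_lt hgtγ) ((le_max_right _ _).trans_lt hgtγ)
  have hsum := heq γ hγ
  set A := Theta γ (ρs γ) ρm * (ρs γ - ρm)
  set B := Theta γ (ρs γ) ρp * (ρs γ - ρp)
  have hfactor : A ^ 2 - B ^ 2 = -(um - A - (um + up) / 2) * (2 * (um - up)) := by
    have hB : B = um - up - A := by linarith
    rw [hB]
    ring
  rw [hfactor, abs_mul, abs_neg, abs_of_pos (by linarith : 0 < 2 * (um - up))] at hle
  rwa [Real.dist_eq, le_div_iff₀ (by linarith)]
end

section
/- Let ρ₋, ρ₊ > 0, u₋ > u₊, β ∈ ℝ and t ≥ 0. Suppose ρ* : (1,2) → ℝ is a continuous function such that for every γ ∈ (1,2), ρ*(γ) > max(ρ₋,ρ₊) and u₋ − u₊ = Θ_γ(ρ*(γ),ρ₋)·(ρ*(γ) − ρ₋) + Θ_γ(ρ*(γ),ρ₊)·(ρ*(γ) − ρ₊). Define the 1-shock speed σ₁^γ(t) = u₋ + βt − ρ*(γ)·Θ_γ(ρ*(γ),ρ₋). Then σ₁^γ(t) → (u₋ + u₊)/2 + βt as γ → 1⁺. -/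
open Real Filter Topology

theorem Theta_nonneg (γ a b : ℝ) : 0 ≤ Theta γ a b := Real.sqrt_nonneg _

theorem sq_Theta_mul_sub {γ a b : ℝ} (hγ : 1 < γ) (hb : 0 < b) (hab : b < a) :
    (Theta γ a b * (a - b)) ^ 2 * ((a + b) / (a - b))
      = (γ - 1) / 2 * (a ^ (γ - 1) - b ^ (γ - 1)) := by
  have hpow : b ^ (γ - 1) ≤ a ^ (γ - 1) :=
    Real.rpow_le_rpow hb.le hab.le (by linarith)
  have h₁ : 0 < a - b := by linarith
  have h₂ : 0 < a + b := by linarith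
  have harg : 0 ≤ ((γ - 1) / 2) * (a ^ (γ - 1) - b ^ (γ - 1)) / ((a + b) * (a - b)) :=
    div_nonneg (mul_nonneg (by linarith) (by linarith)) (by positivity)
  rw [mul_pow, Theta, Real.sq_sqrt harg]
  field_simp

theorem sq_Theta_mul_sub_le {γ a b : ℝ} (hγ : γ ∈ Set.Ioo (1 : ℝ) 2) (hb : 0 < b)
    (hab : b < a) : (Theta γ a b * (a - b)) ^ 2 ≤ (γ - 1) / 2 * max 1 a := by
  have h₁ : 0 < a - b := by linarith
  have hratio : 1 ≤ (a + b) / (a - b) := by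
    rw [le_div_iff₀ h₁]
    linarith
  have hpow : a ^ (γ - 1) ≤ max 1 a :=
    calc a ^ (γ - 1) ≤ (max 1 a) ^ (γ - 1) :=
          Real.rpow_le_rpow (by linarith) (le_max_right _ _) (by linarith [hγ.1])
      _ ≤ (max 1 a) ^ (1 : ℝ) :=
          Real.rpow_le_rpow_of_exponent_le (le_max_left _ _) (by linarith [hγ.2])
      _ = max 1 a := Real.rpow_one _
  have hb' : 0 ≤ b ^ (γ - 1) := Real.rpow_nonneg hb.le _
  calc (Theta γ a b * (a - b)) ^ 2
      ≤ (Theta γ a b * (a - b)) ^ 2 * ((a + b) / (a - b)) :=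
        le_mul_of_one_le_right (sq_nonneg _) hratio
    _ = (γ - 1) / 2 * (a ^ (γ - 1) - b ^ (γ - 1)) := sq_Theta_mul_sub hγ.1 hb hab
    _ ≤ (γ - 1) / 2 * max 1 a :=
        mul_le_mul_of_nonneg_left (by linarith) (by linarith [hγ.1])

theorem tendsto_div_sub_const_atTop (b : ℝ) :
    Tendsto (fun x : ℝ => x / (x - b)) atTop (𝓝 1) := by
  have hsub : Tendsto (fun x : ℝ => x - b) atTop atTop :=
    tendsto_atTop_add_const_right _ (-b) tendsto_id
  have h : Tendsto (fun x : ℝ => 1 + b / (x - b)) atTop (𝓝 (1 + 0)) :=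
    tendsto_const_nhds.add (hsub.const_div_atTop b)
  rw [add_zero] at h
  refine h.congr' ?_
  filter_upwards [eventually_gt_atTop b] with x hx
  have : x - b ≠ 0 := by linarith
  field_simp
  ring

theorem tendsto_add_div_sub_const_atTop (b : ℝ) :
    Tendsto (fun x : ℝ => (x + b) / (x - b)) atTop (𝓝 1) := by
  have h := ((tendsto_div_sub_const_atTop b).const_mul 2).sub_const 1
  norm_num at h
  refine h.congr' ?_
  filter_upwards [eventually_gt_atTop b] with x hx
  have : x - b ≠ 0 := by linarith
  field_simp
  ring

/-- Lemma 4.3: the 1-shock speed σ₁^γ(t) tends to the delta-shock speed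
u_δ(t) = (u₋+u₊)/2 + βt as γ → 1⁺. -/
theorem lemma43_sigma1 (ρm ρp um up β t : ℝ) (hρm : 0 < ρm) (hρp : 0 < ρp)
    (hu : up < um) (ht : 0 ≤ t)
    (ρs : ℝ → ℝ) (hcont : ContinuousOn ρs (Set.Ioo (1 : ℝ) 2))
    (hgt : ∀ γ ∈ Set.Ioo (1 : ℝ) 2, ρs γ > max ρm ρp)
    (heq : ∀ γ ∈ Set.Ioo (1 : ℝ) 2,
      um - up = Theta γ (ρs γ) ρm * (ρs γ - ρm) + Theta γ (ρs γ) ρp * (ρs γ - ρp)) :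
    Tendsto (fun γ : ℝ => um + β * t - ρs γ * Theta γ (ρs γ) ρm)
      (𝓝[>] (1 : ℝ)) (𝓝 ((um + up) / 2 + β * t)) := by
  have hmem : ∀ᶠ γ in 𝓝[>] (1 : ℝ), γ ∈ Set.Ioo (1 : ℝ) 2 :=
    Ioo_mem_nhdsGT one_lt_two
  have hm : ∀ γ ∈ Set.Ioo (1 : ℝ) 2, ρm < ρs γ := fun γ hγ =>
    (le_max_left _ _).trans_lt (hgt γ hγ)
  have hp : ∀ γ ∈ Set.Ioo (1 : ℝ) 2, ρp < ρs γ := fun γ hγ =>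
    (le_max_right _ _).trans_lt (hgt γ hγ)
  set A : ℝ → ℝ := fun γ => Theta γ (ρs γ) ρm * (ρs γ - ρm) with hA
  set B : ℝ → ℝ := fun γ => Theta γ (ρs γ) ρp * (ρs γ - ρp) with hB
  have hA0 : ∀ γ ∈ Set.Ioo (1 : ℝ) 2, 0 ≤ A γ := fun γ hγ =>
    mul_nonneg (Theta_nonneg _ _ _) (sub_nonneg.2 (hm γ hγ).le)
  have hB0 : ∀ γ ∈ Set.Ioo (1 : ℝ) 2, 0 ≤ B γ := fun γ hγ =>
    mul_nonneg (Theta_nonneg _ _ _) (sub_nonneg.2 (hp γ hγ).le)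
  have hAB : ∀ γ ∈ Set.Ioo (1 : ℝ) 2, um - up = A γ + B γ := heq
  have hd : 0 < um - up := sub_pos.2 hu
  have hγ0 : Tendsto (fun γ : ℝ => γ - 1) (𝓝[>] 1) (𝓝 0) := by
    have h : Tendsto (fun γ : ℝ => γ - 1) (𝓝 1) (𝓝 (1 - 1)) :=
      tendsto_id.sub_const 1
    rw [sub_self] at h
    exact h.mono_left nhdsWithin_le_nhds
  have htop : Tendsto ρs (𝓝[>] 1) atTop := by
    refine tendsto_atTop.2 fun K => ?_
    have hsmall := (hγ0.mul_const (2 * max 1 K)).eventually_lt_const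
      (show 0 * (2 * max 1 K) < (um - up) ^ 2 by rw [zero_mul]; positivity)
    filter_upwards [hmem, hsmall] with γ hγ hlt
    by_contra! hK
    have h₁ := sq_Theta_mul_sub_le hγ hρm (hm γ hγ)
    have h₂ := sq_Theta_mul_sub_le hγ hρp (hp γ hγ)
    have h₃ : (γ - 1) * max 1 (ρs γ) ≤ (γ - 1) * max 1 K :=
      mul_le_mul_of_nonneg_left (max_le_max le_rfl hK.le) (by linarith [hγ.1])
    rw [hAB γ hγ] at hlt
    change A γ ^ 2 ≤ _ at h₁
    change B γ ^ 2 ≤ _ at h₂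
    nlinarith [sq_nonneg (A γ - B γ)]
  have hvanish : ∀ (b : ℝ) (F : ℝ → ℝ),
      (∀ γ ∈ Set.Ioo (1 : ℝ) 2, 0 ≤ F γ ∧ F γ ≤ um - up) →
      Tendsto (fun γ => F γ ^ 2 * ((ρs γ + b) / (ρs γ - b) - 1)) (𝓝[>] 1) (𝓝 0) := by
    intro b F hF
    have h := ((tendsto_add_div_sub_const_atTop b).comp htop).sub_const 1
    rw [sub_self] at h
    refine bdd_le_mul_tendsto_zero' ((um - up) ^ 2) ?_ h
    filter_upwards [hmem] with γ hγ
    rw [abs_of_nonneg (sq_nonneg _)]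
    exact pow_le_pow_left₀ (hF γ hγ).1 (hF γ hγ).2 2
  have hpow : ∀ b : ℝ, 0 < b →
      Tendsto (fun γ : ℝ => (γ - 1) / 2 * b ^ (γ - 1)) (𝓝[>] 1) (𝓝 0) := by
    intro b hb
    have h := (hγ0.div_const 2).mul
      ((Real.continuousAt_const_rpow hb.ne').tendsto.comp hγ0)
    simpa using h
  have hsq : Tendsto (fun γ => A γ ^ 2 - B γ ^ 2) (𝓝[>] 1) (𝓝 0) := by
    have h₁ := hvanish ρm A fun γ hγ =>
      ⟨hA0 γ hγ, by linarith [hAB γ hγ, hB0 γ hγ]⟩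
    have h₂ := hvanish ρp B fun γ hγ =>
      ⟨hB0 γ hγ, by linarith [hAB γ hγ, hA0 γ hγ]⟩
    have h := (((hpow ρp hρp).sub (hpow ρm hρm)).sub h₁).add h₂
    simp only [sub_zero, add_zero] at h
    refine h.congr' ?_
    filter_upwards [hmem] with γ hγ
    have h₃ := sq_Theta_mul_sub hγ.1 hρm (hm γ hγ)
    have h₄ := sq_Theta_mul_sub hγ.1 hρp (hp γ hγ)
    change A γ ^ 2 * _ = _ at h₃
    change B γ ^ 2 * _ = _ at h₄
    linarith
  have hAlim : Tendsto A (𝓝[>] 1) (𝓝 ((um - up) / 2)) := by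
    have h := ((hsq.div_const (um - up)).add_const (um - up)).div_const 2
    rw [zero_div, zero_add] at h
    refine h.congr' ?_
    filter_upwards [hmem] with γ hγ
    have hBγ : B γ = um - up - A γ := by linarith [hAB γ hγ]
    rw [hBγ]
    field_simp
    ring
  have hlim := (hAlim.mul ((tendsto_div_sub_const_atTop ρm).comp htop)).const_sub
    (um + β * t)
  rw [show um + β * t - (um - up) / 2 * 1 = (um + up) / 2 + β * t by ring] at hlim
  refine hlim.congr' ?_
  filter_upwards [hmem] with γ hγ
  have : ρs γ - ρm ≠ 0 := (sub_pos.2 (hm γ hγ)).ne'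
  simp only [hA, Function.comp_apply]
  field_simp
end

section
/- Let ρ₋, ρ₊ > 0 and u₋ < u₊. Suppose ρ* : (1,2) → ℝ is a function such that for every γ ∈ (1,2), 0 < ρ*(γ) ≤ min(ρ₋,ρ₊) and u₊ − u₋ = ρ₊^{(γ−1)/2} + ρ₋^{(γ−1)/2} − 2·ρ*(γ)^{(γ−1)/2}. Then ρ*(γ) → 0 as γ → 1⁺. -/
open Real Filter Topology

/-- Positive constants raised to the power `(γ - 1) / 2` tend to `1` as `γ → 1⁺`. -/
theorem tendsto_const_rpow_half_sub_one {a : ℝ} (ha : 0 < a) :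
    Tendsto (fun γ : ℝ => a ^ ((γ - 1) / 2)) (𝓝[>] (1 : ℝ)) (𝓝 1) := by
  have hc : Continuous fun γ : ℝ => a ^ ((γ - 1) / 2) :=
    Continuous.rpow continuous_const (by fun_prop) fun _ => Or.inl ha.ne'
  simpa using (hc.tendsto 1).mono_left nhdsWithin_le_nhds

/-- Core of Theorem 4.6: the intermediate density of the two-rarefaction-wave
Riemann solution cavitates to the vacuum as γ → 1⁺. -/
theorem theorem46_vacuum (ρm ρp um up : ℝ) (hρm : 0 < ρm) (hρp : 0 < ρp)
    (hu : um < up) (ρs : ℝ → ℝ)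
    (hpos : ∀ γ ∈ Set.Ioo (1 : ℝ) 2, 0 < ρs γ ∧ ρs γ ≤ min ρm ρp)
    (heq : ∀ γ ∈ Set.Ioo (1 : ℝ) 2,
      up - um = ρp ^ ((γ - 1) / 2) + ρm ^ ((γ - 1) / 2) - 2 * (ρs γ) ^ ((γ - 1) / 2)) :
    Tendsto ρs (𝓝[>] (1 : ℝ)) (𝓝 0) := by
  have hmem : ∀ᶠ γ in 𝓝[>] (1 : ℝ), γ ∈ Set.Ioo (1 : ℝ) 2 :=
    Ioo_mem_nhdsGT one_lt_two
  refine tendsto_order.2 ⟨fun a ha => ?_, fun ε hε => ?_⟩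
  · filter_upwards [hmem] with γ hγ using ha.trans (hpos γ hγ).1
  · have hlim := ((tendsto_const_rpow_half_sub_one hρp).add
      (tendsto_const_rpow_half_sub_one hρm)).sub
      ((tendsto_const_rpow_half_sub_one hε).const_mul 2)
    have hlt : (1 : ℝ) + 1 - 2 * 1 < up - um := by linarith
    filter_upwards [hmem, hlim.eventually_lt_const hlt] with γ hγ hF
    by_contra! hle
    have hpow : ε ^ ((γ - 1) / 2) ≤ ρs γ ^ ((γ - 1) / 2) :=
      rpow_le_rpow hε.le hle (by linarith [hγ.1])
    linarith [heq γ hγ]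
end

section
/- Let γ ∈ (1,2), ρ₋ > 0 and u₋ ∈ ℝ. Define, for ρ > ρ₋, v(ρ) = u₋ − √( ((γ−1)/2)(ρ^{γ−1} − ρ₋^{γ−1}) / ((ρ+ρ₋)(ρ−ρ₋)) )·(ρ − ρ₋). Then v is strictly decreasing on (ρ₋, ∞), and v(ρ) → −∞ as ρ → +∞. -/
open Real Filter Topology

/-- For `m < x`, the factor `x - m` can be absorbed into the square root. -/
theorem sqrt_div_mul_sub_eq {m x : ℝ} (c : ℝ) (hx : m < x) :
    Real.sqrt (c / ((x + m) * (x - m))) * (x - m) = Real.sqrt (c * ((x - m) / (x + m))) := by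
  have hd : 0 < x - m := sub_pos.2 hx
  conv_lhs => rw [← Real.sqrt_sq hd.le, ← Real.sqrt_mul' _ (sq_nonneg _), Real.sqrt_sq hd.le]
  congr 1
  field_simp

/-- The 1-shock wave curve S₁^γ(ρ₋,u₋) (equation (3.12)) is strictly decreasing on
(ρ₋,∞) and tends to −∞ as ρ → +∞. -/
theorem shock1_curve (γ ρm um : ℝ) (hγ : γ ∈ Set.Ioo (1 : ℝ) 2) (hρm : 0 < ρm) :
    StrictAntiOn
      (fun ρ : ℝ => um -
        Real.sqrt (((γ - 1) / 2) * (ρ ^ (γ - 1) - ρm ^ (γ - 1)) /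
          ((ρ + ρm) * (ρ - ρm))) * (ρ - ρm))
      (Set.Ioi ρm) ∧
    Tendsto
      (fun ρ : ℝ => um -
        Real.sqrt (((γ - 1) / 2) * (ρ ^ (γ - 1) - ρm ^ (γ - 1)) /
          ((ρ + ρm) * (ρ - ρm))) * (ρ - ρm))
      atTop atBot := by
  have ha : 0 < γ - 1 := sub_pos.2 hγ.1
  have hpow : ∀ {x y : ℝ}, ρm ≤ x → x < y → x ^ (γ - 1) < y ^ (γ - 1) := fun hx hxy =>
    Real.rpow_lt_rpow (hρm.le.trans hx) hxy ha
  constructor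
  · intro x hx y hy hxy
    rw [Set.mem_Ioi] at hx hy
    dsimp only
    rw [sqrt_div_mul_sub_eq _ hx, sqrt_div_mul_sub_eq _ hy]
    have hx0 := hpow le_rfl hx
    have hy0 := hpow hx.le hxy
    have hratio : (x - ρm) / (x + ρm) < (y - ρm) / (y + ρm) := by
      rw [div_lt_div_iff₀ (by linarith) (by linarith)]
      nlinarith
    have hxr : 0 < (x - ρm) / (x + ρm) := div_pos (by linarith) (by linarith)
    have hxp : 0 < (γ - 1) / 2 * (x ^ (γ - 1) - ρm ^ (γ - 1)) :=
      mul_pos (by linarith) (by linarith)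
    refine sub_lt_sub_left (Real.sqrt_lt_sqrt (mul_pos hxp hxr).le ?_) _
    gcongr
  · have hlim : Tendsto (fun ρ : ℝ => Real.sqrt
        ((γ - 1) / 2 * (ρ ^ (γ - 1) - ρm ^ (γ - 1)) * (1 / 2))) atTop atTop :=
      Real.tendsto_sqrt_atTop.comp <| Tendsto.atTop_mul_const (by norm_num) <|
        Tendsto.const_mul_atTop (by linarith) <|
          tendsto_atTop_add_const_right _ _ (tendsto_rpow_atTop ha)
    refine tendsto_atBot_add_const_left _ um (tendsto_neg_atTop_atBot.comp
      (tendsto_atTop_mono' _ ?_ hlim))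
    filter_upwards [eventually_ge_atTop (3 * ρm)] with ρ hρ
    have hlt : ρm < ρ := by linarith
    rw [sqrt_div_mul_sub_eq _ hlt]
    have hp : 0 ≤ (γ - 1) / 2 * (ρ ^ (γ - 1) - ρm ^ (γ - 1)) :=
      mul_nonneg (by linarith) (by linarith [hpow le_rfl hlt])
    refine Real.sqrt_le_sqrt (mul_le_mul_of_nonneg_left ?_ hp)
    rw [div_le_div_iff₀ (by norm_num) (by linarith)]
    linarith
end

section
/- Let γ ∈ (1,2), ρ₋ > 0 and u₋ ∈ ℝ. Define, for 0 < ρ < ρ₋, v(ρ) = u₋ + √( ((γ−1)/2)(ρ^{γ−1} − ρ₋^{γ−1}) / ((ρ+ρ₋)(ρ−ρ₋)) )·(ρ − ρ₋) (the quantity under the square root is positive since ρ^{γ−1} − ρ₋^{γ−1} and ρ − ρ₋ are both negative). Then v is strictly increasing on (0, ρ₋), and lim_{ρ→0⁺} v(ρ) = u₋ − √((γ−1)/2)·ρ₋^{(γ−1)/2}. -/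
open Real Filter Topology

/-- For `ρ < ρm` the factor `ρ - ρm` of the shock curve can be absorbed into the square root. -/
lemma sqrt_div_mul_sub_eq_neg_sqrt {c d x ρ ρm : ℝ} (hρ : 0 < ρ) (h : ρ < ρm) :
    √(c * (x - d) / ((ρ + ρm) * (ρ - ρm))) * (ρ - ρm) =
      -√(c * (d - x) * ((ρm - ρ) / (ρ + ρm))) := by
  have h₁ : 0 < ρm - ρ := sub_pos.2 h
  have h₂ : ρ - ρm ≠ 0 := (sub_neg.2 h).ne
  have h₃ : ρ + ρm ≠ 0 := by linarith
  have key : c * (d - x) * ((ρm - ρ) / (ρ + ρm)) =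
      c * (x - d) / ((ρ + ρm) * (ρ - ρm)) * (ρm - ρ) ^ 2 := by
    field_simp
    ring
  rw [key, Real.sqrt_mul' _ (sq_nonneg _), Real.sqrt_sq h₁.le]
  ring

/-- The 2-shock wave curve S₂^γ(ρ₋,u₋) (equation (3.13)) is strictly increasing on
(0,ρ₋) and tends to u₋ − √((γ−1)/2)·ρ₋^{(γ−1)/2} as ρ → 0⁺. -/
theorem shock2_curve (γ ρm um : ℝ) (hγ : γ ∈ Set.Ioo (1 : ℝ) 2) (hρm : 0 < ρm) :
    StrictMonoOn
      (fun ρ : ℝ => um +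
        Real.sqrt (((γ - 1) / 2) * (ρ ^ (γ - 1) - ρm ^ (γ - 1)) /
          ((ρ + ρm) * (ρ - ρm))) * (ρ - ρm))
      (Set.Ioo (0 : ℝ) ρm) ∧
    Tendsto
      (fun ρ : ℝ => um +
        Real.sqrt (((γ - 1) / 2) * (ρ ^ (γ - 1) - ρm ^ (γ - 1)) /
          ((ρ + ρm) * (ρ - ρm))) * (ρ - ρm))
      (𝓝[>] (0 : ℝ)) (𝓝 (um - Real.sqrt ((γ - 1) / 2) * ρm ^ ((γ - 1) / 2))) := by
  obtain ⟨hγ₁, -⟩ := hγ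
  have hs : 0 < γ - 1 := sub_pos.2 hγ₁
  have hc : 0 < (γ - 1) / 2 := half_pos hs
  constructor
  · rintro a ⟨ha, ham⟩ b ⟨hb, hbm⟩ hab
    simp only [sqrt_div_mul_sub_eq_neg_sqrt ha ham, sqrt_div_mul_sub_eq_neg_sqrt hb hbm]
    have hpow : a ^ (γ - 1) < b ^ (γ - 1) := Real.rpow_lt_rpow ha.le hab hs
    have hpow' : b ^ (γ - 1) < ρm ^ (γ - 1) := Real.rpow_lt_rpow hb.le hbm hs
    have hbm' : 0 < ρm - b := sub_pos.2 hbm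
    have hnonneg : 0 ≤ (γ - 1) / 2 * (ρm ^ (γ - 1) - b ^ (γ - 1)) * ((ρm - b) / (b + ρm)) :=
      mul_nonneg (mul_nonneg hc.le (sub_pos.2 hpow').le) (by positivity)
    have hlt : (γ - 1) / 2 * (ρm ^ (γ - 1) - b ^ (γ - 1)) * ((ρm - b) / (b + ρm)) <
        (γ - 1) / 2 * (ρm ^ (γ - 1) - a ^ (γ - 1)) * ((ρm - a) / (a + ρm)) := by
      apply mul_lt_mul'' _ _ (mul_nonneg hc.le (sub_pos.2 hpow').le) (by positivity)
      · gcongr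
      · gcongr
    have hsqrt := Real.sqrt_lt_sqrt hnonneg hlt
    linarith
  · have hlim : ContinuousAt (fun ρ : ℝ => um -
        √((γ - 1) / 2 * (ρm ^ (γ - 1) - ρ ^ (γ - 1)) * ((ρm - ρ) / (ρ + ρm)))) 0 := by
      have hpow : ContinuousAt (fun ρ : ℝ => ρ ^ (γ - 1)) 0 :=
        Real.continuousAt_rpow_const _ _ (Or.inr hs.le)
      have hne : (0 : ℝ) + ρm ≠ 0 := by positivity
      fun_prop (disch := assumption)
    have hval : √((γ - 1) / 2 * (ρm ^ (γ - 1) - 0 ^ (γ - 1)) * ((ρm - 0) / (0 + ρm))) =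
        √((γ - 1) / 2) * ρm ^ ((γ - 1) / 2) := by
      rw [Real.zero_rpow hs.ne', sub_zero, sub_zero, zero_add, div_self hρm.ne', mul_one,
        Real.sqrt_mul hc.le, Real.sqrt_eq_rpow (ρm ^ (γ - 1)), ← Real.rpow_mul hρm.le,
        mul_one_div]
    rw [← hval]
    refine (hlim.tendsto.mono_left nhdsWithin_le_nhds).congr' ?_
    filter_upwards [Ioo_mem_nhdsGT hρm] with ρ hρ
    rw [sqrt_div_mul_sub_eq_neg_sqrt hρ.1 hρ.2, sub_eq_add_neg]
end

section
/- Let γ ∈ (1,2) and ρ₋ > 0. Then for every ρ with 0 < ρ < ρ₋, ρ·√( ((γ−1)/2)(ρ₋^{γ−1} − ρ^{γ−1}) / ((ρ+ρ₋)(ρ₋−ρ)) ) < ((γ−1)/2)·ρ₋^{(γ−1)/2}. -/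
open Real Filter Topology

/-- A secant bound for `x ↦ x ^ a`, from `1 + t ≤ exp t` and `log t < t - 1`. -/
theorem two_mul_sq_mul_rpow_sub_rpow_lt {a x y : ℝ} (ha : 0 < a) (hx : 0 < x) (hxy : x < y) :
    2 * x ^ 2 * (y ^ a - x ^ a) < a * y ^ a * (y ^ 2 - x ^ 2) := by
  have hy : 0 < y := hx.trans hxy
  have hya : 0 < y ^ a := rpow_pos_of_pos hy a
  have hexp : x ^ a = y ^ a * exp (a * (log x - log y)) := by
    rw [rpow_def_of_pos hx, rpow_def_of_pos hy, ← exp_add]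
    ring_nf
  have hlog : 2 * (log y - log x) < (y / x) ^ 2 - 1 := by
    have h1 : 1 < (y / x) ^ 2 := one_lt_pow₀ ((one_lt_div hx).2 hxy) two_ne_zero
    have h := log_lt_sub_one_of_pos (zero_lt_one.trans h1) h1.ne'
    rwa [log_pow, log_div hy.ne' hx.ne', Nat.cast_ofNat] at h
  have hlog' : x ^ 2 * (2 * (log y - log x)) < y ^ 2 - x ^ 2 := by
    calc x ^ 2 * (2 * (log y - log x)) < x ^ 2 * ((y / x) ^ 2 - 1) := by gcongr
      _ = y ^ 2 - x ^ 2 := by field_simp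
  calc 2 * x ^ 2 * (y ^ a - x ^ a)
      = 2 * x ^ 2 * (y ^ a * (1 - exp (a * (log x - log y)))) := by rw [hexp]; ring
    _ ≤ 2 * x ^ 2 * (y ^ a * (a * (log y - log x))) := by
      gcongr
      linarith [add_one_le_exp (a * (log x - log y))]
    _ = a * y ^ a * (x ^ 2 * (2 * (log y - log x))) := by ring
    _ < a * y ^ a * (y ^ 2 - x ^ 2) := by gcongr

/-- The key inequality ruling out 1-shocks with ρ < ρ₋ in Section 3. -/
theorem shock1_entropy_inequality (γ ρm : ℝ) (hγ : γ ∈ Set.Ioo (1 : ℝ) 2)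
    (hρm : 0 < ρm) :
    ∀ ρ : ℝ, 0 < ρ → ρ < ρm →
      ρ * Real.sqrt (((γ - 1) / 2) * (ρm ^ (γ - 1) - ρ ^ (γ - 1)) /
          ((ρ + ρm) * (ρm - ρ)))
        < ((γ - 1) / 2) * ρm ^ ((γ - 1) / 2) := by
  intro ρ hρ hlt
  have ha : 0 < γ - 1 := sub_pos.2 hγ.1
  have hd : 0 < ρm - ρ := sub_pos.2 hlt
  have hsq : (ρm ^ ((γ - 1) / 2)) ^ 2 = ρm ^ (γ - 1) := by
    rw [← rpow_mul_natCast hρm.le, Nat.cast_ofNat, div_mul_cancel₀ _ two_ne_zero]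
  rw [mul_comm, ← lt_div_iff₀ hρ, sqrt_lt' (by positivity), div_pow, mul_pow, hsq,
    div_lt_div_iff₀ (by positivity) (by positivity)]
  have key := mul_lt_mul_of_pos_left (two_mul_sq_mul_rpow_sub_rpow_lt ha hρ hlt)
    (div_pos ha four_pos)
  linear_combination key
end
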